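/- arXiv:2201.04737 — 3 statements merged into one kernel-verified Lean document; each statement's English description precedes it below -/
import Mathlib

section
/- Let X be a real normed vector space, let L1, L2 : X → X, and let U* ∈ X satisfy L2(U*) = 0. Assume there is α1 > 0 such that α1·‖U − V‖ ≤ ‖L1(U) − L1(V)‖ for all U, V ∈ X (coercivity of L1), and there is ν with 0 ≤ ν < 1 such that ‖(L1(U) − L2(U)) − (L1(V) − L2(V))‖ ≤ α1·ν·‖U − V‖ for all U, V ∈ X. Then U* is the unique zero of L2, and any sequence (U^(p)) in X satisfying the defect-correction iteration L1(U^(p+1)) = L1(U^(p)) − L2(U^(p)) for all p ≥ 0 satisfies ‖U^(p) − U*‖ ≤ ν^p · ‖U^(0) − U*‖ for every p ≥ 0. -/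
/-- Defect-correction convergence: if `L1` is coercive with constant `α1` and
`L1 - L2` is Lipschitz with constant `α1·ν`, `ν < 1`, then the zero `U*` of `L2`
is unique and the defect-correction iterates converge geometrically to it. -/
theorem defect_correction_convergence
    {X : Type*} [NormedAddCommGroup X] [NormedSpace ℝ X]
    (L1 L2 : X → X) (Ustar : X) (hUstar : L2 Ustar = 0)
    (α1 : ℝ) (hα1 : 0 < α1)
    (hcoercive : ∀ U V : X, α1 * ‖U - V‖ ≤ ‖L1 U - L1 V‖)
    (ν : ℝ) (hν0 : 0 ≤ ν) (hν1 : ν < 1)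
    (hlip : ∀ U V : X,
      ‖(L1 U - L2 U) - (L1 V - L2 V)‖ ≤ α1 * ν * ‖U - V‖) :
    (∀ V : X, L2 V = 0 → V = Ustar) ∧
    (∀ U : ℕ → X, (∀ p : ℕ, L1 (U (p + 1)) = L1 (U p) - L2 (U p)) →
      ∀ p : ℕ, ‖U p - Ustar‖ ≤ ν ^ p * ‖U 0 - Ustar‖) := by
  have contraction : ∀ V W : X, L1 W = L1 V - L2 V →
      ‖W - Ustar‖ ≤ ν * ‖V - Ustar‖ := by
    intro V W hW
    have hc := hcoercive W Ustar
    have hl := hlip V Ustar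
    rw [hUstar, sub_zero, ← hW, mul_assoc] at hl
    exact le_of_mul_le_mul_left (hc.trans hl) hα1
  refine ⟨fun V hV => ?_, fun U hU p => ?_⟩
  · have h := contraction V V (by rw [hV, sub_zero])
    have h0 : ‖V - Ustar‖ ≤ 0 := by
      by_contra! hpos
      nlinarith
    exact sub_eq_zero.mp (norm_le_zero_iff.mp h0)
  · induction p with
    | zero => simp
    | succ p ih =>
      calc ‖U (p + 1) - Ustar‖ ≤ ν * ‖U p - Ustar‖ := contraction _ _ (hU p)
        _ ≤ ν * (ν ^ p * ‖U 0 - Ustar‖) := mul_le_mul_of_nonneg_left ih hν0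
        _ = ν ^ (p + 1) * ‖U 0 - Ustar‖ := by ring
end

section
/- Let m : ℝ² × ℝ → ℝ² and f1, f2 : ℝ² × ℝ → ℝ² be locally integrable, assume the flux symmetry (f1)₂(x,t) = (f2)₁(x,t) for almost every (x,t), and assume m is a weak solution of the momentum conservation law, i.e. for every compactly supported C¹ function φ : ℝ² × ℝ → ℝ and each component k ∈ {1,2}: ∫ ( m_k·∂φ/∂t + (f1)_k·∂φ/∂x₁ + (f2)_k·∂φ/∂x₂ ) dx dt = 0. Then the angular momentum J := x₁·m₂ − x₂·m₁ is a weak solution of its conservation law: for every compactly supported C¹ function φ, ∫ ( J·∂φ/∂t + ( x₁·(f1)₂ − x₂·(f1)₁ )·∂φ/∂x₁ + ( x₁·(f2)₂ − x₂·(f2)₁ )·∂φ/∂x₂ ) dx dt = 0. -/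
open MeasureTheory

section LocallyIntegrable

variable {X E F : Type*} [MeasurableSpace X] [TopologicalSpace X] [NormedAddCommGroup E]
  [NormedSpace ℝ E] [NormedAddCommGroup F] [NormedSpace ℝ F] {μ : Measure X} {f : X → E × F}

theorem MeasureTheory.LocallyIntegrable.fst_component (hf : LocallyIntegrable f μ) :
    LocallyIntegrable (fun x => (f x).1) μ := fun x =>
  let ⟨s, hs, h⟩ := hf x
  ⟨s, hs, Integrable.fst h⟩

theorem MeasureTheory.LocallyIntegrable.snd_component (hf : LocallyIntegrable f μ) :
    LocallyIntegrable (fun x => (f x).2) μ := fun x =>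
  let ⟨s, hs, h⟩ := hf x
  ⟨s, hs, Integrable.snd h⟩

end LocallyIntegrable

/-- The integrand of the weak form of a conservation law with locally integrable density and
fluxes is integrable, for compactly supported `C¹` test functions. -/
theorem integrable_weak_form {V : Type*} [NormedAddCommGroup V] [NormedSpace ℝ V]
    [MeasurableSpace V] [OpensMeasurableSpace V] {μ : Measure V} {f g h φ : V → ℝ}
    (hf : LocallyIntegrable f μ) (hg : LocallyIntegrable g μ) (hh : LocallyIntegrable h μ)
    (hs : HasCompactSupport φ) (hφ : ContDiff ℝ 1 φ) (u v w : V) :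
    Integrable
      (fun p => f p * fderiv ℝ φ p u + g p * fderiv ℝ φ p v + h p * fderiv ℝ φ p w) μ := by
  have key {k : V → ℝ} (hk : LocallyIntegrable k μ) (z : V) :
      Integrable (fun p => k p * fderiv ℝ φ p z) μ :=
    hk.integrable_smul_right_of_hasCompactSupport
      ((hφ.continuous_fderiv one_ne_zero).clm_apply continuous_const) (hs.fderiv_apply ℝ z)
  exact ((key hf u).add (key hg v)).add (key hh w)

/-- The product rule for the product of a continuous linear functional with a function. -/
theorem fderiv_clm_mul_apply {V : Type*} [NormedAddCommGroup V] [NormedSpace ℝ V]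
    (L : V →L[ℝ] ℝ) {φ : V → ℝ} {p : V} (hφ : DifferentiableAt ℝ φ p) (v : V) :
    fderiv ℝ (fun q => L q * φ q) p v = L p * fderiv ℝ φ p v + L v * φ p := by
  rw [fderiv_fun_mul L.differentiableAt hφ]
  simp [mul_comm]

/-- 2D weak angular momentum conservation: if `m` is a weak solution of the
momentum conservation law with fluxes `f1, f2` satisfying the symmetry
`(f1)₂ = (f2)₁` a.e., then `J = x₁ m₂ - x₂ m₁` is a weak solution of the
angular momentum conservation law.
A point of `ℝ² × ℝ` is encoded as `p : ℝ × ℝ × ℝ` with `x₁ = p.1`,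
`x₂ = p.2.1`, `t = p.2.2`. -/
theorem weak_angular_momentum_conservation_2D
    (m f1 f2 : ℝ × ℝ × ℝ → ℝ × ℝ)
    (hm : LocallyIntegrable m volume)
    (hf1 : LocallyIntegrable f1 volume)
    (hf2 : LocallyIntegrable f2 volume)
    (hsymm : ∀ᵐ p : ℝ × ℝ × ℝ ∂volume, (f1 p).2 = (f2 p).1)
    (hweak1 : ∀ φ : ℝ × ℝ × ℝ → ℝ, HasCompactSupport φ → ContDiff ℝ 1 φ →
      ∫ p : ℝ × ℝ × ℝ,
        ((m p).1 * fderiv ℝ φ p (0, 0, 1) + (f1 p).1 * fderiv ℝ φ p (1, 0, 0)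
          + (f2 p).1 * fderiv ℝ φ p (0, 1, 0)) = 0)
    (hweak2 : ∀ φ : ℝ × ℝ × ℝ → ℝ, HasCompactSupport φ → ContDiff ℝ 1 φ →
      ∫ p : ℝ × ℝ × ℝ,
        ((m p).2 * fderiv ℝ φ p (0, 0, 1) + (f1 p).2 * fderiv ℝ φ p (1, 0, 0)
          + (f2 p).2 * fderiv ℝ φ p (0, 1, 0)) = 0) :
    ∀ φ : ℝ × ℝ × ℝ → ℝ, HasCompactSupport φ → ContDiff ℝ 1 φ →
      ∫ p : ℝ × ℝ × ℝ,
        ((p.1 * (m p).2 - p.2.1 * (m p).1) * fderiv ℝ φ p (0, 0, 1)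
          + (p.1 * (f1 p).2 - p.2.1 * (f1 p).1) * fderiv ℝ φ p (1, 0, 0)
          + (p.1 * (f2 p).2 - p.2.1 * (f2 p).1) * fderiv ℝ φ p (0, 1, 0)) = 0 := by
  intro φ hs hφ
  let L₁ : ℝ × ℝ × ℝ →L[ℝ] ℝ := ContinuousLinearMap.fst ℝ ℝ (ℝ × ℝ)
  let L₂ : ℝ × ℝ × ℝ →L[ℝ] ℝ :=
    (ContinuousLinearMap.fst ℝ ℝ ℝ).comp (ContinuousLinearMap.snd ℝ ℝ (ℝ × ℝ))
  have hs₁ : HasCompactSupport (fun q => L₁ q * φ q) := hs.mul_left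
  have hs₂ : HasCompactSupport (fun q => L₂ q * φ q) := hs.mul_left
  have hφ₁ : ContDiff ℝ 1 (fun q => L₁ q * φ q) := L₁.contDiff.mul hφ
  have hφ₂ : ContDiff ℝ 1 (fun q => L₂ q * φ q) := L₂.contDiff.mul hφ
  have key := congrArg₂ (· - ·) (hweak2 _ hs₁ hφ₁) (hweak1 _ hs₂ hφ₂)
  simp only [sub_zero] at key
  rw [← integral_sub
    (integrable_weak_form hm.snd_component hf1.snd_component hf2.snd_component hs₁ hφ₁ _ _ _)
    (integrable_weak_form hm.fst_component hf1.fst_component hf2.fst_component hs₂ hφ₂ _ _ _)]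
    at key
  refine (integral_congr_ae ?_).trans key
  filter_upwards [hsymm] with p hp
  have hd : DifferentiableAt ℝ φ p := hφ.differentiable one_ne_zero p
  simp only [fderiv_clm_mul_apply _ hd]
  simp only [L₁, L₂, ContinuousLinearMap.comp_apply, ContinuousLinearMap.coe_fst',
    ContinuousLinearMap.coe_snd']
  linear_combination -φ p * hp
end

section
/- Let m : ℝ³ × ℝ → ℝ³ and f1, f2, f3 : ℝ³ × ℝ → ℝ³ be locally integrable, assume the flux symmetries (f2)₃ = (f3)₂, (f3)₁ = (f1)₃ and (f1)₂ = (f2)₁ almost everywhere, and assume m is a weak solution of the momentum conservation law: for every compactly supported C¹ function φ : ℝ³ × ℝ → ℝ and each component k ∈ {1,2,3}, ∫ ( m_k·∂φ/∂t + Σᵢ (fᵢ)_k·∂φ/∂xᵢ ) dx dt = 0. Then J := x × m is a weak solution of the angular momentum conservation law: for every compactly supported C¹ function φ and each component k ∈ {1,2,3}, ∫ ( (x × m)_k·∂φ/∂t + Σᵢ (x × fᵢ)_k·∂φ/∂xᵢ ) dx dt = 0. -/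
open MeasureTheory

/-- The cross product on `ℝ³ = Fin 3 → ℝ`. -/
noncomputable def cross3 (a b : Fin 3 → ℝ) : Fin 3 → ℝ :=
  ![a 1 * b 2 - a 2 * b 1, a 2 * b 0 - a 0 * b 2, a 0 * b 1 - a 1 * b 0]

/-- The product of the coordinate `x i` with a `C¹` function is `C¹`. -/
theorem contDiff_coord_mul {φ : (Fin 3 → ℝ) × ℝ → ℝ} (hφ : ContDiff ℝ 1 φ) (i : Fin 3) :
    ContDiff ℝ 1 fun p : (Fin 3 → ℝ) × ℝ => p.1 i * φ p := by
  fun_prop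

theorem fderiv_coord_mul {φ : (Fin 3 → ℝ) × ℝ → ℝ} (hφ : ContDiff ℝ 1 φ) (i : Fin 3)
    (p v : (Fin 3 → ℝ) × ℝ) :
    fderiv ℝ (fun q : (Fin 3 → ℝ) × ℝ => q.1 i * φ q) p v
      = p.1 i * fderiv ℝ φ p v + v.1 i * φ p := by
  have hcoord : HasFDerivAt (fun q : (Fin 3 → ℝ) × ℝ => q.1 i)
      ((ContinuousLinearMap.proj i).comp (ContinuousLinearMap.fst ℝ (Fin 3 → ℝ) ℝ)) p :=
    ((ContinuousLinearMap.proj i).comp (ContinuousLinearMap.fst ℝ (Fin 3 → ℝ) ℝ)).hasFDerivAt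
  have hφp : HasFDerivAt φ (fderiv ℝ φ p) p :=
    (hφ.differentiable one_ne_zero p).hasFDerivAt
  rw [(hcoord.fun_mul hφp).fderiv]
  simp [mul_comm]

theorem integrable_component_mul_fderiv {g : (Fin 3 → ℝ) × ℝ → Fin 3 → ℝ}
    (hg : LocallyIntegrable g volume) {φ : (Fin 3 → ℝ) × ℝ → ℝ} (hφc : HasCompactSupport φ)
    (hφ : ContDiff ℝ 1 φ) (k : Fin 3) (v : (Fin 3 → ℝ) × ℝ) :
    Integrable (fun p => g p k * fderiv ℝ φ p v) volume := by
  have hcont : Continuous fun p => fderiv ℝ φ p v :=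
    (hφ.continuous_fderiv one_ne_zero).clm_apply continuous_const
  have h := (hg.integrable_smul_left_of_hasCompactSupport hcont
    (hφc.fderiv_apply ℝ v)).eval k
  refine h.congr (Filter.Eventually.of_forall fun p => ?_)
  simp [mul_comm]

/-- The planar moments of a weak solution of a conservation law with symmetric flux `F` are
weakly conserved. -/
theorem weak_moment_conservation {m : (Fin 3 → ℝ) × ℝ → Fin 3 → ℝ}
    {F : Fin 3 → (Fin 3 → ℝ) × ℝ → Fin 3 → ℝ} (hm : LocallyIntegrable m volume)
    (hF : ∀ n, LocallyIntegrable (F n) volume) {i j : Fin 3}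
    (hsymm : ∀ᵐ p : (Fin 3 → ℝ) × ℝ ∂volume, F i p j = F j p i)
    (hweak : ∀ φ : (Fin 3 → ℝ) × ℝ → ℝ, HasCompactSupport φ → ContDiff ℝ 1 φ → ∀ k : Fin 3,
      ∫ p, (m p k * fderiv ℝ φ p (0, 1)
        + ∑ n, F n p k * fderiv ℝ φ p (Pi.single n 1, 0)) = 0)
    {φ : (Fin 3 → ℝ) × ℝ → ℝ} (hφc : HasCompactSupport φ) (hφ : ContDiff ℝ 1 φ) :
    ∫ p : (Fin 3 → ℝ) × ℝ, ((p.1 i * m p j - p.1 j * m p i) * fderiv ℝ φ p (0, 1)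
      + ∑ n, (p.1 i * F n p j - p.1 j * F n p i) * fderiv ℝ φ p (Pi.single n 1, 0)) = 0 := by
  have h_integrable (a k : Fin 3) : Integrable (fun p : (Fin 3 → ℝ) × ℝ =>
      m p k * fderiv ℝ (fun q : (Fin 3 → ℝ) × ℝ => q.1 a * φ q) p (0, 1)
        + ∑ n, F n p k
          * fderiv ℝ (fun q : (Fin 3 → ℝ) × ℝ => q.1 a * φ q) p (Pi.single n 1, 0)) volume :=
    (integrable_component_mul_fderiv hm hφc.mul_left (contDiff_coord_mul hφ a) k _).add
      (integrable_finsetSum _ fun n _ =>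
        integrable_component_mul_fderiv (hF n) hφc.mul_left (contDiff_coord_mul hφ a) k _)
  have hzero (a k : Fin 3) :=
    hweak (fun q : (Fin 3 → ℝ) × ℝ => q.1 a * φ q) hφc.mul_left (contDiff_coord_mul hφ a) k
  have hsub := integral_sub (h_integrable i j) (h_integrable j i)
  rw [hzero i j, hzero j i, sub_zero] at hsub
  refine (integral_congr_ae ?_).trans hsub
  filter_upwards [hsymm] with p hp
  have hdelta (a k : Fin 3) :
      ∑ n, F n p k * ((Pi.single n 1 : Fin 3 → ℝ) a * φ p) = F a p k * φ p := by
    simp [Pi.single_apply]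
  simp only [fderiv_coord_mul hφ, mul_add, Finset.sum_add_distrib, hdelta, hp, sub_mul,
    Finset.sum_sub_distrib, Pi.zero_apply, zero_mul, add_zero, mul_assoc,
    mul_left_comm (p.1 _)]
  ring

/-- 3D weak angular momentum conservation: if `m` is a weak solution of the
momentum conservation law with fluxes `f1, f2, f3` satisfying the symmetries
`(f2)₃ = (f3)₂`, `(f3)₁ = (f1)₃`, `(f1)₂ = (f2)₁` a.e., then `J = x × m` is a
weak solution of the angular momentum conservation law.
A point of `ℝ³ × ℝ` is encoded as `p : (Fin 3 → ℝ) × ℝ` with `x = p.1`,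
`t = p.2`. -/
theorem weak_angular_momentum_conservation_3D
    (m f1 f2 f3 : (Fin 3 → ℝ) × ℝ → Fin 3 → ℝ)
    (hm : LocallyIntegrable m volume)
    (hf1 : LocallyIntegrable f1 volume)
    (hf2 : LocallyIntegrable f2 volume)
    (hf3 : LocallyIntegrable f3 volume)
    (hsymm23 : ∀ᵐ p : (Fin 3 → ℝ) × ℝ ∂volume, f2 p 2 = f3 p 1)
    (hsymm31 : ∀ᵐ p : (Fin 3 → ℝ) × ℝ ∂volume, f3 p 0 = f1 p 2)
    (hsymm12 : ∀ᵐ p : (Fin 3 → ℝ) × ℝ ∂volume, f1 p 1 = f2 p 0)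
    (hweak : ∀ φ : (Fin 3 → ℝ) × ℝ → ℝ, HasCompactSupport φ → ContDiff ℝ 1 φ →
      ∀ k : Fin 3,
        ∫ p : (Fin 3 → ℝ) × ℝ,
          (m p k * fderiv ℝ φ p (0, 1)
            + f1 p k * fderiv ℝ φ p (Pi.single 0 1, 0)
            + f2 p k * fderiv ℝ φ p (Pi.single 1 1, 0)
            + f3 p k * fderiv ℝ φ p (Pi.single 2 1, 0)) = 0) :
    ∀ φ : (Fin 3 → ℝ) × ℝ → ℝ, HasCompactSupport φ → ContDiff ℝ 1 φ →
      ∀ k : Fin 3,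
        ∫ p : (Fin 3 → ℝ) × ℝ,
          (cross3 p.1 (m p) k * fderiv ℝ φ p (0, 1)
            + cross3 p.1 (f1 p) k * fderiv ℝ φ p (Pi.single 0 1, 0)
            + cross3 p.1 (f2 p) k * fderiv ℝ φ p (Pi.single 1 1, 0)
            + cross3 p.1 (f3 p) k * fderiv ℝ φ p (Pi.single 2 1, 0)) = 0 := by
  have hF : ∀ n, LocallyIntegrable (![f1, f2, f3] n) volume := by
    simp [Fin.forall_fin_succ, hf1, hf2, hf3]
  have hw : ∀ φ : (Fin 3 → ℝ) × ℝ → ℝ, HasCompactSupport φ → ContDiff ℝ 1 φ → ∀ k : Fin 3,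
      ∫ p, (m p k * fderiv ℝ φ p (0, 1)
        + ∑ n, ![f1, f2, f3] n p k * fderiv ℝ φ p (Pi.single n 1, 0)) = 0 := by
    simpa [Fin.sum_univ_three, add_assoc] using hweak
  intro φ hφc hφ k
  fin_cases k
  · simpa [cross3, Fin.sum_univ_three, add_assoc] using
      weak_moment_conservation (i := 1) (j := 2) hm hF (by simpa using hsymm23) hw hφc hφ
  · simpa [cross3, Fin.sum_univ_three, add_assoc] using
      weak_moment_conservation (i := 2) (j := 0) hm hF (by simpa using hsymm31) hw hφc hφ
  · simpa [cross3, Fin.sum_univ_three, add_assoc] using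
      weak_moment_conservation (i := 0) (j := 1) hm hF (by simpa using hsymm12) hw hφc hφ
end
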